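/- Let X be a finite-dimensional real Banach space and let F : [0,1] → 2^X \ {∅} be a bounded multifunction. Then I(F) is convex: for all A_1, A_2 ∈ I(F) and all λ ∈ [0,1], the set λA_1 + (1−λ)A_2 belongs to I(F). -/

import Mathlib

open Pointwise Filter Metric Set

/-- A tagged partition of `[0,1]` into finitely many segments with tags. -/
structure TaggedPartition where
  n : ℕ
  pt : Fin (n + 1) → ℝ
  tag : Fin n → ℝ
  pt_zero : pt 0 = 0
  pt_last : pt (Fin.last n) = 1
  pt_mono : Monotone pt
  tag_mem : ∀ i : Fin n, tag i ∈ Set.Icc (pt i.castSucc) (pt i.succ)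

/-- The diameter (mesh) of a tagged partition. -/
noncomputable def TaggedPartition.mesh (P : TaggedPartition) : ℝ :=
  ⨆ i : Fin P.n, (P.pt i.succ - P.pt i.castSucc)

/-- Riemann integral sum of a multifunction, using Minkowski sums and
pointwise scalar multiples of sets. -/
noncomputable def msum {X : Type*} [NormedAddCommGroup X] [NormedSpace ℝ X]
    (F : ℝ → Set X) (P : TaggedPartition) : Set X :=
  ∑ i : Fin P.n, (P.pt i.succ - P.pt i.castSucc) • F (P.tag i)

/-- The set `I(F)` of limits of Riemann integral sums of a multifunction `F`:
all closed nonempty subsets that are Hausdorff-distance limits of sequences of Riemann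
sums along sequences of tagged partitions whose diameters tend to `0`. -/
def limitSets {X : Type*} [NormedAddCommGroup X] [NormedSpace ℝ X]
    (F : ℝ → Set X) : Set (Set X) :=
  {A | A.Nonempty ∧ IsClosed A ∧ ∃ P : ℕ → TaggedPartition,
    Tendsto (fun k => (P k).mesh) atTop (nhds 0) ∧
    Tendsto (fun k => EMetric.hausdorffEdist (msum F (P k)) A) atTop (nhds 0)}

open scoped InnerProductSpace Topology

section HausdorffNear

variable {X : Type*} [NormedAddCommGroup X]

/-- Every point of each of the two sets is within `r` of some point of the other. -/
def HausdorffNear (r : ℝ) (A B : Set X) : Prop :=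
  (∀ a ∈ A, ∃ b ∈ B, ‖a - b‖ ≤ r) ∧ ∀ b ∈ B, ∃ a ∈ A, ‖a - b‖ ≤ r

namespace HausdorffNear

variable {r s : ℝ} {A B C D : Set X}

theorem refl (hr : 0 ≤ r) : HausdorffNear r A A :=
  ⟨fun a ha => ⟨a, ha, by simpa using hr⟩, fun a ha => ⟨a, ha, by simpa using hr⟩⟩

theorem symm (h : HausdorffNear r A B) : HausdorffNear r B A :=
  ⟨fun b hb => let ⟨a, ha, hab⟩ := h.2 b hb; ⟨a, ha, by rwa [norm_sub_rev]⟩,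
    fun a ha => let ⟨b, hb, hab⟩ := h.1 a ha; ⟨b, hb, by rwa [norm_sub_rev]⟩⟩

theorem mono (h : HausdorffNear r A B) (hrs : r ≤ s) : HausdorffNear s A B :=
  ⟨fun a ha => let ⟨b, hb, hab⟩ := h.1 a ha; ⟨b, hb, hab.trans hrs⟩,
    fun b hb => let ⟨a, ha, hab⟩ := h.2 b hb; ⟨a, ha, hab.trans hrs⟩⟩

theorem trans (h₁ : HausdorffNear r A B) (h₂ : HausdorffNear s B C) :
    HausdorffNear (r + s) A C := by
  constructor
  · intro a ha
    obtain ⟨b, hb, hab⟩ := h₁.1 a ha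
    obtain ⟨c, hc, hbc⟩ := h₂.1 b hb
    exact ⟨c, hc, (norm_sub_le_norm_sub_add_norm_sub a b c).trans (add_le_add hab hbc)⟩
  · intro c hc
    obtain ⟨b, hb, hbc⟩ := h₂.2 c hc
    obtain ⟨a, ha, hab⟩ := h₁.2 b hb
    exact ⟨a, ha, (norm_sub_le_norm_sub_add_norm_sub a b c).trans (add_le_add hab hbc)⟩

theorem add (h₁ : HausdorffNear r A B) (h₂ : HausdorffNear s C D) :
    HausdorffNear (r + s) (A + C) (B + D) := by
  constructor
  · rintro _ ⟨a, ha, c, hc, rfl⟩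
    obtain ⟨b, hb, hab⟩ := h₁.1 a ha
    obtain ⟨d, hd, hcd⟩ := h₂.1 c hc
    refine ⟨b + d, Set.add_mem_add hb hd, ?_⟩
    rw [show a + c - (b + d) = (a - b) + (c - d) by abel]
    exact (norm_add_le _ _).trans (add_le_add hab hcd)
  · rintro _ ⟨b, hb, d, hd, rfl⟩
    obtain ⟨a, ha, hab⟩ := h₁.2 b hb
    obtain ⟨c, hc, hcd⟩ := h₂.2 d hd
    refine ⟨a + c, Set.add_mem_add ha hc, ?_⟩
    rw [show a + c - (b + d) = (a - b) + (c - d) by abel]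
    exact (norm_add_le _ _).trans (add_le_add hab hcd)

theorem sum {ι : Type*} (t : Finset ι) {r : ι → ℝ} {A B : ι → Set X}
    (h : ∀ i ∈ t, HausdorffNear (r i) (A i) (B i)) :
    HausdorffNear (∑ i ∈ t, r i) (∑ i ∈ t, A i) (∑ i ∈ t, B i) := by
  classical
  induction t using Finset.induction_on with
  | empty => simpa using refl le_rfl
  | insert a t ha ih =>
    simp only [Finset.sum_insert ha]
    exact (h a (Finset.mem_insert_self _ _)).add
      (ih fun i hi => h i (Finset.mem_insert_of_mem hi))

theorem hausdorffEDist_le (h : HausdorffNear r A B) :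
    hausdorffEDist A B ≤ ENNReal.ofReal r := by
  refine hausdorffEDist_le_of_mem_edist (fun a ha => ?_) fun b hb => ?_
  · obtain ⟨b, hb, hab⟩ := h.1 a ha
    exact ⟨b, hb, by rw [edist_dist, dist_eq_norm]; exact ENNReal.ofReal_le_ofReal hab⟩
  · obtain ⟨a, ha, hab⟩ := h.2 b hb
    exact ⟨a, ha, by rw [edist_comm, edist_dist, dist_eq_norm]; exact ENNReal.ofReal_le_ofReal hab⟩

theorem of_hausdorffEDist_lt (hr : 0 < r) (h : hausdorffEDist A B < ENNReal.ofReal r) :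
    HausdorffNear r A B := by
  constructor
  · intro a ha
    obtain ⟨b, hb, hab⟩ := exists_edist_lt_of_hausdorffEDist_lt ha h
    rw [edist_dist, ENNReal.ofReal_lt_ofReal_iff hr, dist_eq_norm] at hab
    exact ⟨b, hb, hab.le⟩
  · intro b hb
    rw [hausdorffEDist_comm] at h
    obtain ⟨a, ha, hab⟩ := exists_edist_lt_of_hausdorffEDist_lt hb h
    rw [edist_comm, edist_dist, ENNReal.ofReal_lt_ofReal_iff hr, dist_eq_norm] at hab
    exact ⟨a, ha, hab.le⟩

variable [NormedSpace ℝ X]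

theorem smul (h : HausdorffNear r A B) {c : ℝ} (hc : 0 ≤ c) :
    HausdorffNear (c * r) (c • A) (c • B) := by
  constructor
  · rintro _ ⟨a, ha, rfl⟩
    obtain ⟨b, hb, hab⟩ := h.1 a ha
    refine ⟨c • b, Set.smul_mem_smul_set hb, ?_⟩
    simp only [← smul_sub, norm_smul, Real.norm_of_nonneg hc]
    gcongr
  · rintro _ ⟨b, hb, rfl⟩
    obtain ⟨a, ha, hab⟩ := h.2 b hb
    refine ⟨c • a, Set.smul_mem_smul_set ha, ?_⟩
    simp only [← smul_sub, norm_smul, Real.norm_of_nonneg hc]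
    gcongr

theorem convexHull (h : HausdorffNear r A B) :
    HausdorffNear r (convexHull ℝ A) (convexHull ℝ B) := by
  have key : ∀ {A B : Set X}, (∀ a ∈ A, ∃ b ∈ B, ‖a - b‖ ≤ r) →
      ∀ a ∈ _root_.convexHull ℝ A, ∃ b ∈ _root_.convexHull ℝ B, ‖a - b‖ ≤ r := by
    intro A B hAB a ha
    have hsub : A ⊆ _root_.convexHull ℝ B + closedBall (0 : X) r := by
      intro x hx
      obtain ⟨b, hb, hxb⟩ := hAB x hx
      exact ⟨b, subset_convexHull ℝ B hb, x - b, by simpa using hxb, by simp⟩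
    obtain ⟨b, hb, d, hd, rfl⟩ :=
      convexHull_min hsub ((convex_convexHull ℝ B).add (convex_closedBall 0 r)) ha
    exact ⟨b, hb, by simpa using hd⟩
  refine ⟨key h.1, fun b hb => ?_⟩
  obtain ⟨a, ha, hab⟩ := key h.symm.1 b hb
  exact ⟨a, ha, by rwa [norm_sub_rev]⟩

theorem smul_smul_of_norm_le {M : ℝ} (hA : ∀ a ∈ A, ‖a‖ ≤ M) (c d : ℝ) :
    HausdorffNear (|c - d| * M) (c • A) (d • A) := by
  constructor
  · rintro _ ⟨a, ha, rfl⟩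
    refine ⟨d • a, Set.smul_mem_smul_set ha, ?_⟩
    simp only [← sub_smul, norm_smul, Real.norm_eq_abs]
    gcongr
    exact hA a ha
  · rintro _ ⟨a, ha, rfl⟩
    refine ⟨c • a, Set.smul_mem_smul_set ha, ?_⟩
    simp only [← sub_smul, norm_smul, Real.norm_eq_abs]
    gcongr
    exact hA a ha

end HausdorffNear

end HausdorffNear

section Selection

variable {V E : Type*} [AddCommGroup V] [Module ℝ V] [NormedAddCommGroup E]
  [InnerProductSpace ℝ E]

theorem exists_mem_norm_add_sub_sq_le (L : V →ₗ[ℝ] E) {C : Set V} {v : V}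
    (hv : v ∈ convexHull ℝ C) {R : ℝ} (hR : ∀ x ∈ C, ‖L (x - v)‖ ≤ R) (z : E) :
    ∃ c ∈ C, ‖z + L (c - v)‖ ^ 2 ≤ ‖z‖ ^ 2 + R ^ 2 := by
  obtain ⟨c, hc, hle⟩ : ∃ c ∈ C, ⟪z, L c⟫_ℝ ≤ ⟪z, L v⟫_ℝ := by
    by_contra! hcon
    have hconv : Convex ℝ {x : V | ⟪z, L v⟫_ℝ < ⟪z, L x⟫_ℝ} :=
      convex_halfSpace_gt (((innerₛₗ ℝ z).comp L).isLinear) _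
    have hlt : v ∈ {x : V | ⟪z, L v⟫_ℝ < ⟪z, L x⟫_ℝ} := convexHull_min hcon hconv hv
    exact lt_irrefl ⟪z, L v⟫_ℝ hlt
  refine ⟨c, hc, ?_⟩
  have h₁ : ⟪z, L (c - v)⟫_ℝ ≤ 0 := by
    rw [map_sub, inner_sub_right]; linarith
  have h₂ : ‖L (c - v)‖ ^ 2 ≤ R ^ 2 := pow_le_pow_left₀ (norm_nonneg _) (hR c hc) 2
  rw [norm_add_sq_real]
  linarith

/-- A Shapley–Folkman type selection: points of convex hulls can be replaced by points of the
sets themselves so that the error of the sum is controlled in the `ℓ²` sense. -/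
theorem exists_selection_norm_sum_sub_sq_le {ι : Type*} (t : Finset ι) (L : V →ₗ[ℝ] E)
    {C : ι → Set V} {v : ι → V} {R : ι → ℝ} (hv : ∀ i, v i ∈ convexHull ℝ (C i))
    (hR : ∀ i, ∀ x ∈ C i, ‖L (x - v i)‖ ≤ R i) :
    ∃ c : ι → V, (∀ i ∈ t, c i ∈ C i) ∧
      ‖∑ i ∈ t, L (c i - v i)‖ ^ 2 ≤ ∑ i ∈ t, R i ^ 2 := by
  classical
  induction t using Finset.induction_on with
  | empty => exact ⟨v, by simp⟩
  | insert a t ha ih =>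
    obtain ⟨c, hc, hle⟩ := ih
    obtain ⟨x, hx, hxle⟩ := exists_mem_norm_add_sub_sq_le L (hv a) (hR a)
      (∑ i ∈ t, L (c i - v i))
    have hne : ∀ i ∈ t, Function.update c a x i = c i := fun i hi =>
      Function.update_of_ne (ne_of_mem_of_not_mem hi ha) _ _
    refine ⟨Function.update c a x, fun i hi => ?_, ?_⟩
    · rcases Finset.mem_insert.1 hi with rfl | hi
      · simpa using hx
      · rw [hne i hi]; exact hc i hi
    · rw [Finset.sum_insert ha, Finset.sum_insert ha, Function.update_self,
        Finset.sum_congr rfl fun i hi => by rw [hne i hi], add_comm]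
      linarith

end Selection

section TaggedChain

variable {Y : Type*} [NormedAddCommGroup Y]

/-- `TaggedChain e δ a c w`: the interval `[a, c]` has a tagged partition of mesh at most `δ`
whose Riemann sum for the function `e` is `w`. -/
inductive TaggedChain [NormedSpace ℝ Y] (e : ℝ → Y) (δ : ℝ) : ℝ → ℝ → Y → Prop
  | nil (a : ℝ) : TaggedChain e δ a a 0
  | cons {a t b c : ℝ} {w : Y} (hat : a ≤ t) (htb : t ≤ b) (hδ : b - a ≤ δ)
      (h : TaggedChain e δ b c w) : TaggedChain e δ a c ((b - a) • e t + w)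

namespace TaggedChain

section NormedSpace

variable [NormedSpace ℝ Y] {e : ℝ → Y} {δ : ℝ}

theorem le {a c : ℝ} {w : Y} (h : TaggedChain e δ a c w) : a ≤ c := by
  induction h with
  | nil => exact le_rfl
  | cons hat htb _ _ ih => linarith

theorem mono {δ' a c : ℝ} {w : Y} (h : TaggedChain e δ a c w) (hδ : δ ≤ δ') :
    TaggedChain e δ' a c w := by
  induction h with
  | nil a => exact nil a
  | cons hat htb h _ ih => exact cons hat htb (h.trans hδ) ih

theorem append {a b c : ℝ} {w₁ w₂ : Y} (h₁ : TaggedChain e δ a b w₁)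
    (h₂ : TaggedChain e δ b c w₂) : TaggedChain e δ a c (w₁ + w₂) := by
  induction h₁ with
  | nil a => simpa using h₂
  | cons hat htb h _ ih => rw [add_assoc]; exact cons hat htb h (ih h₂)

theorem norm_le (he : ∀ t, ‖e t‖ ≤ 1) {a c : ℝ} {w : Y} (h : TaggedChain e δ a c w) :
    ‖w‖ ≤ c - a := by
  induction h with
  | nil => simp
  | @cons a t b c w hat htb hδ h ih =>
    have h₁ : ‖(b - a) • e t‖ ≤ b - a := by
      rw [norm_smul, Real.norm_of_nonneg (by linarith)]
      exact mul_le_of_le_one_right (by linarith) (he t)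
    linarith [norm_add_le ((b - a) • e t) w]

/-- A chain can be cut at an intermediate point at the cost of an error of the order of the
mesh. -/
theorem exists_split (he : ∀ t, ‖e t‖ ≤ 1) (hδ₀ : 0 ≤ δ) {a c m : ℝ} {w : Y}
    (h : TaggedChain e δ a c w) (ham : a ≤ m) (hmc : m ≤ c) :
    ∃ w₁ w₂, TaggedChain e δ a m w₁ ∧ TaggedChain e δ m c w₂ ∧
      ‖w₁ + w₂ - w‖ ≤ 2 * δ := by
  induction h with
  | nil a =>
    obtain rfl := le_antisymm ham hmc
    exact ⟨0, 0, nil _, nil _, by simpa using hδ₀⟩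
  | @cons a t b c w hat htb hδ h ih =>
    rcases le_total b m with hbm | hmb
    · obtain ⟨w₁, w₂, h₁, h₂, hle⟩ := ih hbm hmc
      refine ⟨_, w₂, cons hat htb hδ h₁, h₂, ?_⟩
      rwa [show (b - a) • e t + w₁ + w₂ - ((b - a) • e t + w) = w₁ + w₂ - w by abel]
    · have key : ∀ x y : ℝ, 0 ≤ x → x ≤ δ → ‖x • (e m - e y)‖ ≤ 2 * δ := by
        intro x y hx hxδ
        rw [norm_smul, Real.norm_of_nonneg hx]
        nlinarith [norm_sub_le (e m) (e y), he m, he y, norm_nonneg (e m - e y)]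
      rcases le_total t m with htm | hmt
      · refine ⟨_, _, cons hat htm (by linarith) (nil m),
          cons le_rfl hmb (by linarith) h, ?_⟩
        convert key (b - m) t (by linarith) (by linarith) using 2
        module
      · refine ⟨_, _, cons ham le_rfl (by linarith) (nil m),
          cons hmt htb (by linarith) h, ?_⟩
        convert key (m - a) t (by linarith) (by linarith) using 2
        module

theorem of_fin (n : ℕ) (pt : Fin (n + 1) → ℝ) (tag : Fin n → ℝ)
    (htag : ∀ i : Fin n, tag i ∈ Icc (pt i.castSucc) (pt i.succ))
    (hδ : ∀ i : Fin n, pt i.succ - pt i.castSucc ≤ δ) :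
    TaggedChain e δ (pt 0) (pt (Fin.last n))
      (∑ i, (pt i.succ - pt i.castSucc) • e (tag i)) := by
  induction n with
  | zero => simpa using nil (e := e) (δ := δ) (pt 0)
  | succ n ih =>
    rw [Fin.sum_univ_succ]
    exact cons (htag 0).1 (htag 0).2 (hδ 0)
      (ih (fun i => pt i.succ) (fun i => tag i.succ) (fun i => htag i.succ) fun i => hδ i.succ)

theorem exists_fin {a c : ℝ} {w : Y} (h : TaggedChain e δ a c w) :
    ∃ (n : ℕ) (pt : Fin (n + 1) → ℝ) (tag : Fin n → ℝ), pt 0 = a ∧ pt (Fin.last n) = c ∧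
      (∀ i : Fin n, tag i ∈ Icc (pt i.castSucc) (pt i.succ)) ∧
      (∀ i : Fin n, pt i.succ - pt i.castSucc ≤ δ) ∧
      ∑ i, (pt i.succ - pt i.castSucc) • e (tag i) = w := by
  induction h with
  | nil a => exact ⟨0, fun _ => a, Fin.elim0, rfl, rfl, fun i => i.elim0, fun i => i.elim0, by simp⟩
  | @cons a t b c w hat htb hδ h ih =>
    obtain ⟨n, pt, tag, rfl, rfl, htag, hmesh, rfl⟩ := ih
    refine ⟨n + 1, Fin.cons a pt, Fin.cons t tag, by simp, ?_, ?_, ?_, ?_⟩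
    · rw [← Fin.succ_last, Fin.cons_succ]
    · refine Fin.cases ⟨by simpa using hat, by simpa using htb⟩ fun i => ?_
      simpa [← Fin.succ_castSucc] using htag i
    · refine Fin.cases (by simpa using hδ) fun i => ?_
      simpa [← Fin.succ_castSucc] using hmesh i
    · rw [Fin.sum_univ_succ]
      simp

end NormedSpace

/-- Two tagged partitions of the same interval, the second one much finer than the first one, can
be merged into a single one whose Riemann sum is close to a prescribed convex combination. -/
theorem exists_merge [InnerProductSpace ℝ Y] {e : ℝ → Y} {δ : ℝ} (he : ∀ t, ‖e t‖ ≤ 1)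
    {l : ℝ} (hl : l ∈ Icc (0 : ℝ) 1) {a c : ℝ} {u : Y} (h : TaggedChain e δ a c u) :
    ∃ K : ℝ, 0 ≤ K ∧ ∀ δ', 0 ≤ δ' → δ' ≤ δ → ∀ v, TaggedChain e δ' a c v → ∀ z : Y,
      ∃ w v', TaggedChain e δ a c w ∧ ‖v' - v‖ ≤ K * δ' ∧
        ‖z + (w - (l • u + (1 - l) • v'))‖ ^ 2 ≤ ‖z‖ ^ 2 + 4 * δ * (c - a) := by
  induction h with
  | nil a =>
    refine ⟨0, le_rfl, fun δ' _ _ v hv z => ⟨0, 0, nil a, ?_, by simp⟩⟩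
    have := hv.norm_le he
    simpa using this
  | @cons a t b c u hat htb hδ h ih =>
    obtain ⟨K, hK, ih⟩ := ih
    refine ⟨K + 2, by linarith, fun δ' hδ'₀ hδ' v hv z => ?_⟩
    obtain ⟨v₁, v₂, hv₁, hv₂, hv⟩ := hv.exists_split he hδ'₀ (hat.trans htb) h.le
    set p : Y := (b - a) • e t
    have hp_chain : TaggedChain e δ a b p := by
      simpa using cons hat htb hδ (nil (e := e) b)
    have hp_norm := hp_chain.norm_le he
    have hv₁_norm := hv₁.norm_le he
    have hconv : l • p + (1 - l) • v₁ ∈ convexHull ℝ {p, v₁} := by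
      rw [convexHull_pair]
      exact ⟨l, 1 - l, hl.1, by linarith [hl.2], by ring, rfl⟩
    have hmean : ‖l • p + (1 - l) • v₁‖ ≤ b - a := by
      have := convexHull_min (t := closedBall (0 : Y) (b - a))
        (by rintro x (rfl | rfl) <;> simpa) (convex_closedBall _ _) hconv
      simpa using this
    obtain ⟨x, hx, hxz⟩ := exists_mem_norm_add_sub_sq_le (LinearMap.id : Y →ₗ[ℝ] Y)
      hconv (R := 2 * (b - a)) (by
        rintro x (rfl | rfl) <;> rw [LinearMap.id_apply] <;>
        exact (norm_sub_le _ _).trans (by linarith)) z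
    rw [LinearMap.id_apply] at hxz
    have hx_chain : TaggedChain e δ a b x := by
      rcases hx with rfl | rfl
      exacts [hp_chain, hv₁.mono hδ']
    obtain ⟨w, v', hw, hv', hz⟩ := ih δ' hδ'₀ hδ' v₂ hv₂ (z + (x - (l • p + (1 - l) • v₁)))
    refine ⟨x + w, v₁ + v', hx_chain.append hw, ?_, ?_⟩
    · calc ‖v₁ + v' - v‖ = ‖(v' - v₂) + (v₁ + v₂ - v)‖ := by congr 1; abel
        _ ≤ K * δ' + 2 * δ' := (norm_add_le _ _).trans (add_le_add hv' hv)
        _ = (K + 2) * δ' := by ring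
    · have hsum : z + (x + w - (l • (p + u) + (1 - l) • (v₁ + v'))) =
          z + (x - (l • p + (1 - l) • v₁)) + (w - (l • u + (1 - l) • v')) := by module
      rw [hsum]
      nlinarith [hxz, hz, mul_nonneg (sub_nonneg.2 hδ) (sub_nonneg.2 (hat.trans htb))]

end TaggedChain

end TaggedChain

namespace TaggedPartition

variable (P : TaggedPartition)

theorem length_nonneg (i : Fin P.n) : 0 ≤ P.pt i.succ - P.pt i.castSucc :=
  sub_nonneg.2 (P.pt_mono i.castSucc_le_succ)

theorem length_le_mesh (i : Fin P.n) : P.pt i.succ - P.pt i.castSucc ≤ P.mesh :=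
  le_ciSup (f := fun i : Fin P.n => P.pt i.succ - P.pt i.castSucc)
    (Set.finite_range _).bddAbove i

theorem mesh_nonneg : 0 ≤ P.mesh :=
  Real.iSup_nonneg P.length_nonneg

theorem sum_length : ∑ i : Fin P.n, (P.pt i.succ - P.pt i.castSucc) = 1 := by
  have key : ∀ (n : ℕ) (p : Fin (n + 1) → ℝ),
      ∑ i : Fin n, (p i.succ - p i.castSucc) = p (Fin.last n) - p 0 := by
    intro n p
    induction n with
    | zero => simp
    | succ n ih =>
      have := ih fun i => p i.succ
      rw [Fin.sum_univ_succ]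
      simp only [Fin.succ_castSucc, Fin.succ_last] at this
      rw [this]
      simp
  rw [key, P.pt_last, P.pt_zero, sub_zero]

theorem tag_mem_Icc (i : Fin P.n) : P.tag i ∈ Icc (0 : ℝ) 1 := by
  refine ⟨?_, ?_⟩
  · rw [← P.pt_zero]
    exact (P.pt_mono (Fin.zero_le _)).trans (P.tag_mem i).1
  · rw [← P.pt_last]
    exact (P.tag_mem i).2.trans (P.pt_mono (Fin.le_last _))

/-- The Riemann sum of a single-valued function. -/
def riemannSum {Y : Type*} [NormedAddCommGroup Y] [NormedSpace ℝ Y] (e : ℝ → Y) : Y :=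
  ∑ i : Fin P.n, (P.pt i.succ - P.pt i.castSucc) • e (P.tag i)

theorem taggedChain {Y : Type*} [NormedAddCommGroup Y] [NormedSpace ℝ Y] (e : ℝ → Y) {δ : ℝ}
    (hδ : P.mesh ≤ δ) : TaggedChain e δ 0 1 (P.riemannSum e) := by
  have := TaggedChain.of_fin (e := e) (δ := δ) P.n P.pt P.tag P.tag_mem
    fun i => (P.length_le_mesh i).trans hδ
  rwa [P.pt_zero, P.pt_last] at this

end TaggedPartition

theorem TaggedChain.exists_taggedPartition {Y : Type*} [NormedAddCommGroup Y] [NormedSpace ℝ Y]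
    {e : ℝ → Y} {δ : ℝ} (hδ : 0 ≤ δ) {w : Y} (h : TaggedChain e δ 0 1 w) :
    ∃ P : TaggedPartition, P.mesh ≤ δ ∧ P.riemannSum e = w := by
  obtain ⟨n, pt, tag, h0, h1, htag, hmesh, hsum⟩ := h.exists_fin
  exact ⟨⟨n, pt, tag, h0, h1,
    Fin.monotone_iff_le_succ.2 fun i => (htag i).1.trans (htag i).2, htag⟩,
    Real.iSup_le hmesh hδ, hsum⟩

section FiniteDimensional

universe u

variable {X : Type u} [NormedAddCommGroup X] [NormedSpace ℝ X]

theorem norm_le_of_mem_convexHull {A : Set X} {M : ℝ} (hA : ∀ a ∈ A, ‖a‖ ≤ M) {x : X}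
    (hx : x ∈ convexHull ℝ A) : ‖x‖ ≤ M := by
  have := convexHull_min (t := closedBall (0 : X) M)
    (fun a ha => by simpa using hA a ha) (convex_closedBall _ _) hx
  simpa using this

theorem norm_le_of_mem_smul {A : Set X} {M c : ℝ} (hc : 0 ≤ c) (hA : ∀ a ∈ A, ‖a‖ ≤ M)
    {x : X} (hx : x ∈ c • A) : ‖x‖ ≤ c * M := by
  obtain ⟨a, ha, rfl⟩ := hx
  simp only [norm_smul, Real.norm_of_nonneg hc]
  exact mul_le_mul_of_nonneg_left (hA a ha) hc

theorem Convex.sum_smul {C : Set X} (hC : Convex ℝ C) (hne : C.Nonempty) {ι : Type*}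
    (t : Finset ι) {d : ι → ℝ} (hd : ∀ i, 0 ≤ d i) :
    ∑ i ∈ t, d i • C = (∑ i ∈ t, d i) • C := by
  classical
  induction t using Finset.induction_on with
  | empty => simp [Set.zero_smul_set hne]
  | insert a t ha ih =>
    rw [Finset.sum_insert ha, Finset.sum_insert ha, ih,
      hC.add_smul (hd a) (Finset.sum_nonneg fun i _ => hd i)]

theorem exists_hausdorffNear_convexHull_sum [FiniteDimensional ℝ X] (M : ℝ) :
    ∃ K : ℝ, ∀ (n : ℕ) (d : Fin n → ℝ) (B : Fin n → Set X) (η : ℝ), (∀ i, 0 ≤ d i) →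
      (∀ i, d i ≤ η) → ∑ i, d i = 1 → (∀ i, ∀ x ∈ B i, ‖x‖ ≤ M) →
      HausdorffNear (K * √η) (∑ i, d i • B i) (convexHull ℝ (∑ i, d i • B i)) := by
  set L := toEuclidean (E := X)
  set N := ‖(L : X →L[ℝ] EuclideanSpace ℝ (Fin (Module.finrank ℝ X)))‖
  set N' := ‖(L.symm : EuclideanSpace ℝ (Fin (Module.finrank ℝ X)) →L[ℝ] X)‖
  refine ⟨N' * |N * (2 * M)|, fun n d B η hd hdη hsum hB => ⟨fun a ha => ?_, fun b hb => ?_⟩⟩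
  · exact ⟨a, subset_convexHull ℝ _ ha, by rw [sub_self, norm_zero]; positivity⟩
  · rw [convexHull_sum, Set.mem_fintype_sum] at hb
    obtain ⟨v, hv, rfl⟩ := hb
    have hnorm : ∀ i, ∀ x ∈ d i • B i, ‖x‖ ≤ d i * M := fun i x hx =>
      norm_le_of_mem_smul (hd i) (hB i) hx
    obtain ⟨c, hc, hle⟩ := exists_selection_norm_sum_sub_sq_le Finset.univ
      (L : X →ₗ[ℝ] EuclideanSpace ℝ (Fin (Module.finrank ℝ X))) (C := fun i => d i • B i) hv
      (R := fun i => N * (2 * M) * d i) (by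
        intro i x hx
        have h₁ : ‖x - v i‖ ≤ 2 * M * d i := by
          have := norm_sub_le x (v i)
          linarith [hnorm i x hx, norm_le_of_mem_convexHull (hnorm i) (hv i)]
        calc ‖L (x - v i)‖ ≤ N * ‖x - v i‖ :=
              (L : X →L[ℝ] EuclideanSpace ℝ (Fin (Module.finrank ℝ X))).le_opNorm _
          _ ≤ N * (2 * M * d i) := by gcongr
          _ = N * (2 * M) * d i := by ring)
    refine ⟨∑ i, c i, Set.mem_fintype_sum _ _ |>.2 ⟨c, fun i => hc i (Finset.mem_univ i), rfl⟩, ?_⟩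
    have hsq : ∑ i, (N * (2 * M) * d i) ^ 2 ≤ (N * (2 * M)) ^ 2 * η := by
      calc ∑ i, (N * (2 * M) * d i) ^ 2 ≤ ∑ i, (N * (2 * M)) ^ 2 * (η * d i) := by
            refine Finset.sum_le_sum fun i _ => ?_
            rw [mul_pow, sq (d i)]
            gcongr
            exacts [hd i, hdη i]
        _ = (N * (2 * M)) ^ 2 * η := by
            rw [← Finset.mul_sum, ← Finset.mul_sum, hsum, mul_one]
    have hle' := Real.le_sqrt_of_sq_le (hle.trans hsq)
    rw [Real.sqrt_mul (sq_nonneg _), Real.sqrt_sq_eq_abs] at hle'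
    calc ‖∑ i, c i - ∑ i, v i‖
        = ‖L.symm (∑ i, L (c i - v i))‖ := by
          rw [← map_sum, L.symm_apply_apply, Finset.sum_sub_distrib]
      _ ≤ N' * ‖∑ i, L (c i - v i)‖ :=
          (L.symm : EuclideanSpace ℝ (Fin (Module.finrank ℝ X)) →L[ℝ] X).le_opNorm _
      _ ≤ N' * (|N * (2 * M)| * √η) := by gcongr; exact hle'
      _ = N' * |N * (2 * M)| * √η := by ring

/-- A bounded multifunction with values in a finite-dimensional space is uniformly close to one
with finitely many values. -/
theorem exists_finite_classification [FiniteDimensional ℝ X] {F : ℝ → Set X} {M : ℝ}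
    (hF : ∀ t ∈ Icc (0 : ℝ) 1, ∀ a ∈ F t, ‖a‖ ≤ M) {ε : ℝ} (hε : 0 < ε) :
    ∃ (κ : Type u) (_ : Finite κ) (τ : ℝ → κ) (s : κ → ℝ), (∀ j, s j ∈ Icc (0 : ℝ) 1) ∧
      ∀ t ∈ Icc (0 : ℝ) 1, HausdorffNear ε (F t) (F (s (τ t))) := by
  classical
  have hcpt : IsCompact (closedBall (0 : X) M) := by
    have := FiniteDimensional.proper ℝ X
    exact isCompact_closedBall _ _
  obtain ⟨N, -, hN, hcover⟩ := hcpt.finite_cover_balls (half_pos hε)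
  have := hN.to_subtype
  set τ : ℝ → Set N := fun t => {y | ∃ a ∈ F t, ‖a - y‖ ≤ ε / 2}
  have hnet : ∀ t ∈ Icc (0 : ℝ) 1, ∀ a ∈ F t, ∃ y ∈ τ t, ‖a - y‖ ≤ ε / 2 := by
    intro t ht a ha
    obtain ⟨y, hy, hay⟩ := mem_iUnion₂.1 (hcover (by simpa using hF t ht a ha))
    rw [mem_ball, dist_eq_norm] at hay
    exact ⟨⟨y, hy⟩, ⟨a, ha, hay.le⟩, hay.le⟩
  have key : ∀ t ∈ Icc (0 : ℝ) 1, ∀ t', τ t = τ t' →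
      ∀ a ∈ F t, ∃ b ∈ F t', ‖a - b‖ ≤ ε := by
    intro t ht t' heq a ha
    obtain ⟨y, hy, hay⟩ := hnet t ht a ha
    rw [heq] at hy
    obtain ⟨b, hb, hby⟩ := hy
    refine ⟨b, hb, ?_⟩
    rw [norm_sub_rev] at hby
    linarith [norm_sub_le_norm_sub_add_norm_sub a (y : X) b]
  refine ⟨Set N, inferInstance, τ,
    fun j => if h : ∃ t ∈ Icc (0 : ℝ) 1, τ t = j then h.choose else 0, fun j => ?_,
    fun t ht => ?_⟩
  · beta_reduce
    split_ifs with h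
    exacts [h.choose_spec.1, by simp]
  · have h : ∃ t' ∈ Icc (0 : ℝ) 1, τ t' = τ t := ⟨t, ht, rfl⟩
    beta_reduce
    rw [dif_pos h]
    refine ⟨key t ht _ h.choose_spec.2.symm, fun b hb => ?_⟩
    obtain ⟨a, ha, hab⟩ := key _ h.choose_spec.1 t h.choose_spec.2 b hb
    exact ⟨a, ha, by rwa [norm_sub_rev]⟩

variable {κ : Type*} [Fintype κ]

theorem hausdorffNear_sum_smul {B : κ → Set X} {M : ℝ} (hM : 0 ≤ M)
    (hB : ∀ j, ∀ x ∈ B j, ‖x‖ ≤ M) (w w' : EuclideanSpace ℝ κ) :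
    HausdorffNear (Fintype.card κ * M * ‖w - w'‖) (∑ j, w j • B j) (∑ j, w' j • B j) := by
  refine (HausdorffNear.sum Finset.univ fun j _ =>
    HausdorffNear.smul_smul_of_norm_le (hB j) (w j) (w' j)).mono ?_
  calc ∑ j, |w j - w' j| * M ≤ ∑ _j : κ, ‖w - w'‖ * M := by
        refine Finset.sum_le_sum fun j _ => ?_
        gcongr
        simpa using PiLp.norm_apply_le (w - w') j
    _ = Fintype.card κ * M * ‖w - w'‖ := by simp; ring

variable [DecidableEq κ]

theorem TaggedPartition.riemannSum_single_apply (P : TaggedPartition) (τ : ℝ → κ) (j : κ) :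
    P.riemannSum (fun t => EuclideanSpace.single (τ t) (1 : ℝ)) j =
      ∑ i : Fin P.n with τ (P.tag i) = j, (P.pt i.succ - P.pt i.castSucc) := by
  rw [Finset.sum_filter, TaggedPartition.riemannSum]
  simp [Pi.single_apply, eq_comm]

theorem TaggedPartition.riemannSum_single_nonneg (P : TaggedPartition) (τ : ℝ → κ) (j : κ) :
    0 ≤ P.riemannSum (fun t => EuclideanSpace.single (τ t) (1 : ℝ)) j := by
  rw [P.riemannSum_single_apply]
  exact Finset.sum_nonneg fun i _ => P.length_nonneg i

theorem hausdorffNear_convexHull_msum {F : ℝ → Set X}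
    (hFne : ∀ t ∈ Icc (0 : ℝ) 1, (F t).Nonempty) {ε : ℝ} {τ : ℝ → κ} {s : κ → ℝ}
    (hs : ∀ j, s j ∈ Icc (0 : ℝ) 1)
    (hτ : ∀ t ∈ Icc (0 : ℝ) 1, HausdorffNear ε (F t) (F (s (τ t)))) (P : TaggedPartition) :
    HausdorffNear ε (convexHull ℝ (msum F P))
      (∑ j, P.riemannSum (fun t => EuclideanSpace.single (τ t) (1 : ℝ)) j •
        convexHull ℝ (F (s j))) := by
  have hsum : ∑ j, P.riemannSum (fun t => EuclideanSpace.single (τ t) (1 : ℝ)) j •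
      convexHull ℝ (F (s j)) = ∑ i : Fin P.n, (P.pt i.succ - P.pt i.castSucc) •
        convexHull ℝ (F (s (τ (P.tag i)))) := by
    rw [← Finset.sum_fiberwise Finset.univ (fun i => τ (P.tag i))]
    refine Finset.sum_congr rfl fun j _ => ?_
    rw [P.riemannSum_single_apply, ← (convex_convexHull ℝ (F (s j))).sum_smul
      (hFne _ (hs j)).convexHull _ P.length_nonneg]
    refine Finset.sum_congr rfl fun i hi => ?_
    rw [(Finset.mem_filter.1 hi).2]
  have h := HausdorffNear.sum Finset.univ fun (i : Fin P.n) _ =>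
    (hτ _ (P.tag_mem_Icc i)).convexHull.smul (P.length_nonneg i)
  rw [← Finset.sum_mul, P.sum_length, one_mul] at h
  rw [hsum, msum, convexHull_sum]
  simpa only [convexHull_smul] using h

end FiniteDimensional

section LimitSets

variable {X : Type*} [NormedAddCommGroup X] [NormedSpace ℝ X] {F : ℝ → Set X} {M : ℝ}

theorem norm_le_of_mem_msum (hF : ∀ t ∈ Icc (0 : ℝ) 1, ∀ a ∈ F t, ‖a‖ ≤ M)
    (P : TaggedPartition) {x : X} (hx : x ∈ msum F P) : ‖x‖ ≤ M := by
  rw [msum, Set.mem_fintype_sum] at hx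
  obtain ⟨g, hg, rfl⟩ := hx
  calc ‖∑ i, g i‖ ≤ ∑ i, ‖g i‖ := norm_sum_le _ _
    _ ≤ ∑ i : Fin P.n, (P.pt i.succ - P.pt i.castSucc) * M := Finset.sum_le_sum fun i _ =>
        norm_le_of_mem_smul (P.length_nonneg i) (hF _ (P.tag_mem_Icc i)) (hg i)
    _ = M := by rw [← Finset.sum_mul, P.sum_length, one_mul]

theorem exists_taggedPartition_hausdorffNear {A : Set X} (hA : A ∈ limitSets F) {ε η : ℝ}
    (hε : 0 < ε) (hη : 0 < η) :
    ∃ P : TaggedPartition, P.mesh ≤ η ∧ HausdorffNear ε (msum F P) A := by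
  obtain ⟨-, -, P, hmesh, hlim⟩ := hA
  obtain ⟨k, hk₁, hk₂⟩ := ((hmesh.eventually_lt_const hη).and
    (hlim.eventually_lt_const (ENNReal.ofReal_pos.2 hε))).exists
  exact ⟨P k, hk₁.le, HausdorffNear.of_hausdorffEDist_lt hε hk₂⟩

theorem isCompact_of_mem_limitSets [FiniteDimensional ℝ X]
    (hF : ∀ t ∈ Icc (0 : ℝ) 1, ∀ a ∈ F t, ‖a‖ ≤ M) {A : Set X} (hA : A ∈ limitSets F) :
    IsCompact A := by
  have := FiniteDimensional.proper ℝ X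
  obtain ⟨P, -, hP⟩ := exists_taggedPartition_hausdorffNear hA one_pos one_pos
  refine (isCompact_closedBall (0 : X) (M + 1)).of_isClosed_subset hA.2.1 fun a ha => ?_
  obtain ⟨b, hb, hba⟩ := hP.2 a ha
  rw [mem_closedBall_zero_iff]
  rw [norm_sub_rev] at hba
  linarith [norm_le_of_mem_msum hF P hb, norm_le_norm_add_norm_sub' a b]

theorem exists_msum_hausdorffNear_combination [FiniteDimensional ℝ X]
    (hFne : ∀ t ∈ Icc (0 : ℝ) 1, (F t).Nonempty)
    (hF : ∀ t ∈ Icc (0 : ℝ) 1, ∀ a ∈ F t, ‖a‖ ≤ M) {A₁ A₂ : Set X} (hA₁ : A₁ ∈ limitSets F)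
    (hA₂ : A₂ ∈ limitSets F) {l : ℝ} (hl : l ∈ Icc (0 : ℝ) 1) {ε : ℝ} (hε : 0 < ε) :
    ∃ Q : TaggedPartition, Q.mesh ≤ ε ∧
      HausdorffNear (6 * ε) (msum F Q) (l • A₁ + (1 - l) • A₂) := by
  classical
  have hM : 0 ≤ M := by
    obtain ⟨a, ha⟩ := hFne 0 (by simp)
    exact (norm_nonneg a).trans (hF 0 (by simp) a ha)
  have hl' : 0 ≤ 1 - l := sub_nonneg.2 hl.2
  obtain ⟨κ, hκ, τ, s, hs, hτ⟩ := exists_finite_classification hF hε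
  have := Fintype.ofFinite κ
  obtain ⟨K, hK⟩ := exists_hausdorffNear_convexHull_sum (X := X) M
  set e : ℝ → EuclideanSpace ℝ κ := fun t => EuclideanSpace.single (τ t) (1 : ℝ)
  have he : ∀ t, ‖e t‖ ≤ 1 := fun t => by simp [e]
  set W : EuclideanSpace ℝ κ → Set X := fun w => ∑ j, w j • convexHull ℝ (F (s j)) with hW
  set D : ℝ := Fintype.card κ * M
  have hD₀ : 0 ≤ D := by positivity
  have hsmall : ∀ g : ℝ → ℝ, Continuous g → g 0 = 0 → ∀ r > 0, ∀ᶠ η in 𝓝[>] (0 : ℝ), g η < r :=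
    fun g hg hg0 r hr => ((hg.tendsto 0).mono_left nhdsWithin_le_nhds).eventually_lt_const
      (by rwa [hg0])
  obtain ⟨η, ⟨⟨hηε, hKη⟩, hDη⟩, hη⟩ := (((hsmall (fun η => η) (by fun_prop) rfl ε hε).and
    (hsmall (fun η => K * √η) (by fun_prop) (by simp) ε hε)).and
    (hsmall (fun η => D * (2 * √η)) (by fun_prop) (by simp) (ε / 2) (half_pos hε))).and
    self_mem_nhdsWithin |>.exists
  replace hη : 0 < η := hη
  -- Riemann sums of small mesh are determined by the sums of `e`, up to a small error.
  have hmsum : ∀ P : TaggedPartition, P.mesh ≤ η →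
      HausdorffNear (2 * ε) (msum F P) (W (P.riemannSum e)) := by
    intro P hP
    have h := hK P.n _ (fun i => F (P.tag i)) η P.length_nonneg
      (fun i => (P.length_le_mesh i).trans hP) P.sum_length fun i => hF _ (P.tag_mem_Icc i)
    exact (h.trans (hausdorffNear_convexHull_msum hFne hs hτ P)).mono (by linarith)
  obtain ⟨P₁, hP₁, hnear₁⟩ := exists_taggedPartition_hausdorffNear hA₁ hε hη
  obtain ⟨K', hK', hmerge⟩ := (P₁.taggedChain e hP₁).exists_merge he hl
  obtain ⟨δ, ⟨hδη, hDδ⟩, hδ⟩ := ((hsmall (fun δ => δ) (by fun_prop) rfl η hη).and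
    (hsmall (fun δ => D * (K' * δ)) (by fun_prop) (by simp) (ε / 2) (half_pos hε))).and
    self_mem_nhdsWithin |>.exists
  replace hδ : 0 < δ := hδ
  obtain ⟨P₂, hP₂, hnear₂⟩ := exists_taggedPartition_hausdorffNear hA₂ hε hδ
  obtain ⟨w, v', hw, hv', hwv'⟩ := hmerge δ hδ.le hδη.le _ (P₂.taggedChain e hP₂) 0
  obtain ⟨Q, hQ, rfl⟩ := hw.exists_taggedPartition hη.le
  set u := P₁.riemannSum e
  set v := P₂.riemannSum e
  have hdist : ‖Q.riemannSum e - (l • u + (1 - l) • v)‖ ≤ 2 * √η + K' * δ := by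
    have h₁ : ‖Q.riemannSum e - (l • u + (1 - l) • v')‖ ≤ 2 * √η := by
      refine abs_le_of_sq_le_sq' ?_ (by positivity) |>.2
      rw [mul_pow, Real.sq_sqrt hη.le]
      simpa [show (2 : ℝ) ^ 2 = 4 by norm_num] using hwv'
    have h₂ : ‖(1 - l) • (v' - v)‖ ≤ K' * δ := by
      rw [norm_smul, Real.norm_of_nonneg hl']
      exact (mul_le_of_le_one_left (norm_nonneg _) (by linarith [hl.1])).trans hv'
    rw [show Q.riemannSum e - (l • u + (1 - l) • v) =
      (Q.riemannSum e - (l • u + (1 - l) • v')) + (1 - l) • (v' - v) by module]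
    exact (norm_add_le _ _).trans (add_le_add h₁ h₂)
  have hW_near : HausdorffNear ε (W (Q.riemannSum e)) (W (l • u + (1 - l) • v)) := by
    refine (hausdorffNear_sum_smul hM
      (fun j x hx => norm_le_of_mem_convexHull (hF _ (hs j)) hx) _ _).mono ?_
    calc D * ‖Q.riemannSum e - (l • u + (1 - l) • v)‖ ≤ D * (2 * √η + K' * δ) := by gcongr
      _ ≤ ε := by linarith
  have hW_comb : W (l • u + (1 - l) • v) = l • W u + (1 - l) • W v := by
    simp only [hW, Finset.smul_sum, ← Finset.sum_add_distrib, smul_smul]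
    refine Finset.sum_congr rfl fun j _ => ?_
    rw [← (convex_convexHull ℝ (F (s j))).add_smul
      (mul_nonneg hl.1 (P₁.riemannSum_single_nonneg τ j))
      (mul_nonneg hl' (P₂.riemannSum_single_nonneg τ j))]
    simp [u, v, e]
  refine ⟨Q, hQ.trans hηε.le, ?_⟩
  have h₁ := ((hmsum P₁ hP₁).symm.trans hnear₁).smul hl.1
  have h₂ := ((hmsum P₂ (hP₂.trans hδη.le)).symm.trans hnear₂).smul hl'
  rw [hW_comb] at hW_near
  exact (((hmsum Q hQ).trans hW_near).trans (h₁.add h₂)).mono (by linarith)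

end LimitSets

/-- For a bounded multifunction on `[0,1]` with values in a finite-dimensional real
Banach space, `I(F)` is convex (with respect to Minkowski combinations). -/
theorem limitSets_convex_of_finiteDimensional
    {X : Type*} [NormedAddCommGroup X] [NormedSpace ℝ X] [FiniteDimensional ℝ X]
    (F : ℝ → Set X)
    (hFne : ∀ t ∈ Set.Icc (0 : ℝ) 1, (F t).Nonempty)
    (hFbdd : ∃ M : ℝ, ∀ t ∈ Set.Icc (0 : ℝ) 1, ∀ a ∈ F t, ‖a‖ ≤ M) :
    ∀ A₁ ∈ limitSets F, ∀ A₂ ∈ limitSets F, ∀ l ∈ Set.Icc (0 : ℝ) 1,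
      l • A₁ + (1 - l) • A₂ ∈ limitSets F := by
  intro A₁ hA₁ A₂ hA₂ l hl
  obtain ⟨M, hF⟩ := hFbdd
  refine ⟨(hA₁.1.smul_set).add hA₂.1.smul_set,
    (((isCompact_of_mem_limitSets hF hA₁).smul l).add
      ((isCompact_of_mem_limitSets hF hA₂).smul (1 - l))).isClosed, ?_⟩
  choose Q hmesh hnear using fun k : ℕ => exists_msum_hausdorffNear_combination hFne hF hA₁ hA₂ hl
    (Nat.one_div_pos_of_nat (α := ℝ) (n := k))
  refine ⟨Q, squeeze_zero (fun k => (Q k).mesh_nonneg) hmesh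
    tendsto_one_div_add_atTop_nhds_zero_nat, ?_⟩
  refine tendsto_of_tendsto_of_tendsto_of_le_of_le tendsto_const_nhds ?_
    (fun _ => zero_le) fun k => (hnear k).hausdorffEDist_le
  have h := ENNReal.tendsto_ofReal
    ((tendsto_one_div_add_atTop_nhds_zero_nat (𝕜 := ℝ)).const_mul 6)
  simpa using h
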